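/- arXiv:1803.04233 — 5 statements merged into one kernel-verified Lean document; each statement's English description precedes it below -/
import Mathlib

section
/- (Half-space case of Theorem 2.2(3).) Let d ≥ 2, V : ℝ^d → ℝ smooth, Q : H → Sym_d(ℝ) continuous and q : ℝ^{d−1} → ℝ continuous. The following are equivalent: (i) −Hess_V(x) − Q(x) is positive semidefinite for every x ∈ H and −∂_d V(x̂, 0) ≥ q(x̂) for every x̂ ∈ ℝ^{d−1}; (ii) for every f ∈ C_c^∞(ℝ^d) with f(x̂,0) = 0 for all x̂, one has ∫_H { (Lf)² − ‖Hess_f‖²_HS − ⟨Q ∇f, ∇f⟩ } dμ ≥ ∫_{ℝ^{d−1}} q(x̂) (∂_d f(x̂,0))² dμ_∂. -/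
open MeasureTheory Real

/-- Partial derivative `∂ᵢ f` on `ℝ^n = Fin n → ℝ`. -/
noncomputable def pd {n : ℕ} (i : Fin n) (f : (Fin n → ℝ) → ℝ) (x : Fin n → ℝ) : ℝ :=
  fderiv ℝ f x (Pi.single i 1)

/-- Hessian entry `∂ᵢ∂ⱼ f`. -/
noncomputable def hess {n : ℕ} (i j : Fin n) (f : (Fin n → ℝ) → ℝ) (x : Fin n → ℝ) : ℝ :=
  pd i (pd j f) x

/-- Euclidean Laplacian `Δf`. -/
noncomputable def lap {n : ℕ} (f : (Fin n → ℝ) → ℝ) (x : Fin n → ℝ) : ℝ :=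
  ∑ i, hess i i f x

/-- Weighted Laplacian `L f = Δ f + ⟨∇V, ∇f⟩`. -/
noncomputable def Lop {n : ℕ} (V f : (Fin n → ℝ) → ℝ) (x : Fin n → ℝ) : ℝ :=
  lap f x + ∑ i, pd i V x * pd i f x

/-- Squared Hilbert-Schmidt norm of the Hessian of `f`. -/
noncomputable def hessHS2 {n : ℕ} (f : (Fin n → ℝ) → ℝ) (x : Fin n → ℝ) : ℝ :=
  ∑ i, ∑ j, (hess i j f x) ^ 2

/-- The Hessian of `V` as a bilinear form evaluated at vectors `u, v`. -/
noncomputable def hessBil {n : ℕ} (V : (Fin n → ℝ) → ℝ) (x : Fin n → ℝ)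
    (u v : Fin n → ℝ) : ℝ :=
  ∑ i, ∑ j, hess i j V x * u i * v j

/-- The gradient `∇f`. -/
noncomputable def grad {n : ℕ} (f : (Fin n → ℝ) → ℝ) (x : Fin n → ℝ) : Fin n → ℝ :=
  fun i => pd i f x

/-- The closed upper half-space `H = {x ∈ ℝ^{d+1} : x_{d+1} ≥ 0}`. -/
def upperHalf (d : ℕ) : Set (Fin (d + 1) → ℝ) := {x | 0 ≤ x (Fin.last d)}

section HalfSpace

open Set Filter Topology

section Calculus

variable {n : ℕ} {f g : (Fin n → ℝ) → ℝ}

lemma contDiff_pd (i : Fin n) (hf : ContDiff ℝ (⊤ : ℕ∞) f) :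
    ContDiff ℝ (⊤ : ℕ∞) (pd i f) :=
  (hf.fderiv_right (m := (⊤ : ℕ∞)) (by simp)).clm_apply contDiff_const

lemma contDiff_hess (i j : Fin n) (hf : ContDiff ℝ (⊤ : ℕ∞) f) :
    ContDiff ℝ (⊤ : ℕ∞) (hess i j f) :=
  contDiff_pd i (contDiff_pd j hf)

lemma contDiff_Lop {V : (Fin n → ℝ) → ℝ} (hV : ContDiff ℝ (⊤ : ℕ∞) V)
    (hf : ContDiff ℝ (⊤ : ℕ∞) f) : ContDiff ℝ (⊤ : ℕ∞) (Lop V f) :=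
  (ContDiff.sum fun i _ => contDiff_hess i i hf).add
    (ContDiff.sum fun i _ => (contDiff_pd i hV).mul (contDiff_pd i hf))

lemma ContDiff.differentiableAt_of_smooth (hf : ContDiff ℝ (⊤ : ℕ∞) f) (x : Fin n → ℝ) :
    DifferentiableAt ℝ f x :=
  (hf.differentiable (by simp)) x

lemma pd_add (i : Fin n) {x : Fin n → ℝ} (hf : DifferentiableAt ℝ f x)
    (hg : DifferentiableAt ℝ g x) :
    pd i (fun y => f y + g y) x = pd i f x + pd i g x := by
  simp [pd, fderiv_fun_add hf hg]

lemma pd_sub (i : Fin n) {x : Fin n → ℝ} (hf : DifferentiableAt ℝ f x)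
    (hg : DifferentiableAt ℝ g x) :
    pd i (fun y => f y - g y) x = pd i f x - pd i g x := by
  simp [pd, fderiv_fun_sub hf hg]

lemma pd_mul (i : Fin n) {x : Fin n → ℝ} (hf : DifferentiableAt ℝ f x)
    (hg : DifferentiableAt ℝ g x) :
    pd i (fun y => f y * g y) x = f x * pd i g x + g x * pd i f x := by
  simp [pd, fderiv_fun_mul hf hg]

lemma pd_exp (i : Fin n) {x : Fin n → ℝ} (hf : DifferentiableAt ℝ f x) :
    pd i (fun y => exp (f y)) x = exp (f x) * pd i f x := by
  simp [pd, fderiv_exp hf]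

lemma pd_sum {ι : Type*} (s : Finset ι) (i : Fin n) {F : ι → (Fin n → ℝ) → ℝ} {x : Fin n → ℝ}
    (hF : ∀ k ∈ s, DifferentiableAt ℝ (F k) x) :
    pd i (fun y => ∑ k ∈ s, F k y) x = ∑ k ∈ s, pd i (F k) x := by
  simp [pd, fderiv_fun_sum hF]

lemma pd_comm (i j : Fin n) (hf : ContDiff ℝ (⊤ : ℕ∞) f) (x : Fin n → ℝ) :
    pd i (pd j f) x = pd j (pd i f) x := by
  have h1 : DifferentiableAt ℝ (fderiv ℝ f) x :=
    (hf.fderiv_right (m := (⊤ : ℕ∞)) (by simp)).differentiable (by simp) x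
  have h2 : IsSymmSndFDerivAt ℝ f x :=
    hf.contDiffAt.isSymmSndFDerivAt 
      (by simpa using WithTop.coe_le_coe.2 (le_top : (2 : ℕ∞) ≤ ⊤))
  have key : ∀ k l : Fin n, pd k (pd l f) x
      = fderiv ℝ (fderiv ℝ f) x (Pi.single k 1) (Pi.single l 1) := by
    intro k l
    change fderiv ℝ (fun y => fderiv ℝ f y (Pi.single l 1)) x (Pi.single k 1) = _
    rw [fderiv_clm_apply h1 (differentiableAt_const _)]
    simp
  rw [key, key]
  exact h2 _ _

lemma hess_comm (i j : Fin n) (hf : ContDiff ℝ (⊤ : ℕ∞) f) (x : Fin n → ℝ) :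
    hess i j f x = hess j i f x :=
  pd_comm i j hf x

lemma pd_eq_zero_of_notMem_tsupport (i : Fin n) {x : Fin n → ℝ} (hx : x ∉ tsupport f) :
    pd i f x = 0 := by
  have : fderiv ℝ f x = 0 := by
    by_contra h
    exact hx (support_fderiv_subset ℝ h)
  simp [pd, this]

lemma hasCompactSupport_pd (i : Fin n) (hf : HasCompactSupport f) :
    HasCompactSupport (pd i f) :=
  HasCompactSupport.intro hf.isCompact fun _ hx => pd_eq_zero_of_notMem_tsupport i hx

/-- The `i`-th component of the vector field `e^V (Lf ∇f - Hess_f ∇f)`. -/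
noncomputable def bochnerField (V f : (Fin n → ℝ) → ℝ) (i : Fin n) (x : Fin n → ℝ) : ℝ :=
  exp (V x) * (Lop V f x * pd i f x - ∑ j, pd j f x * hess i j f x)

lemma contDiff_bochnerField {V : (Fin n → ℝ) → ℝ} (hV : ContDiff ℝ (⊤ : ℕ∞) V)
    (hf : ContDiff ℝ (⊤ : ℕ∞) f) (i : Fin n) : ContDiff ℝ (⊤ : ℕ∞) (bochnerField V f i) :=
  hV.exp.mul (((contDiff_Lop hV hf).mul (contDiff_pd i hf)).sub
    (ContDiff.sum fun j _ => (contDiff_pd j hf).mul (contDiff_hess i j hf)))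

lemma hasCompactSupport_bochnerField {V : (Fin n → ℝ) → ℝ} (hf : HasCompactSupport f)
    (i : Fin n) : HasCompactSupport (bochnerField V f i) :=
  HasCompactSupport.intro hf.isCompact fun x hx => by
    simp [bochnerField, pd_eq_zero_of_notMem_tsupport _ hx]

lemma pd_Lop {V : (Fin n → ℝ) → ℝ} (hV : ContDiff ℝ (⊤ : ℕ∞) V)
    (hf : ContDiff ℝ (⊤ : ℕ∞) f) (i : Fin n) (x : Fin n → ℝ) :
    pd i (Lop V f) x = ∑ j, pd j (pd j (pd i f)) x
      + ∑ j, (pd j V x * hess i j f x + pd j f x * hess i j V x) := by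
  have hL : Lop V f = fun y => (∑ j, hess j j f y) + ∑ j, pd j V y * pd j f y := rfl
  rw [hL, pd_add, pd_sum, pd_sum]
  · congr 1
    · refine Finset.sum_congr rfl fun j _ => ?_
      have : pd i (pd j f) = pd j (pd i f) := funext fun y => pd_comm i j hf y
      rw [← this]
      exact pd_comm i j (contDiff_pd j hf) x
    · refine Finset.sum_congr rfl fun j _ => ?_
      rw [pd_mul i ((contDiff_pd j hV).differentiableAt_of_smooth x)
        ((contDiff_pd j hf).differentiableAt_of_smooth x)]
      rfl
  · exact fun j _ => ((contDiff_pd j hV).mul (contDiff_pd j hf)).differentiableAt_of_smooth x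
  · exact fun j _ => (contDiff_hess j j hf).differentiableAt_of_smooth x
  · exact (ContDiff.sum fun j _ => contDiff_hess j j hf).differentiableAt_of_smooth x
  · exact (ContDiff.sum fun j _ =>
      (contDiff_pd j hV).mul (contDiff_pd j hf)).differentiableAt_of_smooth x

lemma pd_bochnerField {V : (Fin n → ℝ) → ℝ} (hV : ContDiff ℝ (⊤ : ℕ∞) V)
    (hf : ContDiff ℝ (⊤ : ℕ∞) f) (i : Fin n) (x : Fin n → ℝ) :
    pd i (bochnerField V f i) x = exp (V x) * (Lop V f x * hess i i f x
      + pd i f x * pd i (Lop V f) x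
      - ∑ j, (pd j f x * pd i (pd i (pd j f)) x + hess i j f x * hess i j f x)
      + (Lop V f x * pd i f x - ∑ j, pd j f x * hess i j f x) * pd i V x) := by
  have hsum : ContDiff ℝ (⊤ : ℕ∞) fun y => ∑ j, pd j f y * hess i j f y :=
    ContDiff.sum fun j _ => (contDiff_pd j hf).mul (contDiff_hess i j hf)
  have hL := contDiff_Lop hV hf
  have hLi := hL.mul (contDiff_pd i hf)
  have hX : bochnerField V f i = fun y => exp (V y) *
    (Lop V f y * pd i f y - ∑ j, pd j f y * hess i j f y) := rfl
  rw [hX, pd_mul i (hV.exp.differentiableAt_of_smooth x)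
      ((hLi.sub hsum).differentiableAt_of_smooth x),
    pd_sub i (hLi.differentiableAt_of_smooth x) (hsum.differentiableAt_of_smooth x),
    pd_mul i (hL.differentiableAt_of_smooth x) ((contDiff_pd i hf).differentiableAt_of_smooth x),
    pd_exp i (hV.differentiableAt_of_smooth x), pd_sum _ i fun j _ =>
      ((contDiff_pd j hf).mul (contDiff_hess i j hf)).differentiableAt_of_smooth x]
  have h : ∀ j, pd i (fun y => pd j f y * hess i j f y) x
      = pd j f x * pd i (pd i (pd j f)) x + hess i j f x * hess i j f x := fun j =>
    pd_mul i ((contDiff_pd j hf).differentiableAt_of_smooth x)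
      ((contDiff_hess i j hf).differentiableAt_of_smooth x)
  rw [Finset.sum_congr rfl fun j _ => h j]
  simp only [hess]
  ring

/-- The pointwise Bochner identity: the divergence of `bochnerField`. -/
lemma sum_pd_bochnerField {V : (Fin n → ℝ) → ℝ} (hV : ContDiff ℝ (⊤ : ℕ∞) V)
    (hf : ContDiff ℝ (⊤ : ℕ∞) f) (x : Fin n → ℝ) :
    ∑ i, pd i (bochnerField V f i) x = ((Lop V f x) ^ 2 - hessHS2 f x
      + ∑ i, ∑ j, hess i j V x * pd i f x * pd j f x) * exp (V x) := by
  have hT : ∑ i, ∑ j, pd i f x * pd j (pd j (pd i f)) x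
      = ∑ i, ∑ j, pd j f x * pd i (pd i (pd j f)) x := Finset.sum_comm
  have hv : ∑ i, ∑ j, pd i f x * (pd j V x * hess i j f x)
      = ∑ i, ∑ j, pd j f x * hess i j f x * pd i V x := by
    rw [Finset.sum_comm]
    refine Finset.sum_congr rfl fun i _ => Finset.sum_congr rfl fun j _ => ?_
    rw [hess_comm j i hf]
    ring
  have hw : ∑ i, ∑ j, pd i f x * (pd j f x * hess i j V x)
      = ∑ i, ∑ j, hess i j V x * pd i f x * pd j f x :=
    Finset.sum_congr rfl fun i _ => Finset.sum_congr rfl fun j _ => by ring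
  have hL : Lop V f x * Lop V f x = ∑ i, Lop V f x * hess i i f x
      + ∑ i, Lop V f x * pd i f x * pd i V x := by
    nth_rewrite 2 [Lop]
    rw [mul_add, lap, Finset.mul_sum, Finset.mul_sum]
    congr 1
    exact Finset.sum_congr rfl fun i _ => by ring
  simp only [pd_bochnerField hV hf, pd_Lop hV hf, ← Finset.mul_sum]
  rw [mul_comm]
  congr 1
  simp only [mul_add, sub_mul, Finset.sum_add_distrib, Finset.sum_sub_distrib, Finset.mul_sum,
    Finset.sum_mul, hT, hv, hw]
  rw [sq, hL, hessHS2]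
  simp only [sq]
  ring

end Calculus

section HalfSpaceIntegrals

variable {d : ℕ}

lemma isClosed_upperHalf (d : ℕ) : IsClosed (upperHalf d) :=
  isClosed_le continuous_const (continuous_apply _)

lemma continuous_snoc_zero (d : ℕ) :
    Continuous fun y : Fin d → ℝ => (Fin.snoc y 0 : Fin (d + 1) → ℝ) := by
  refine continuous_pi fun i => ?_
  refine Fin.lastCases ?_ (fun j => ?_) i
  · simpa using continuous_const
  · simpa using continuous_apply j

lemma snoc_zero_mem_upperHalf (y : Fin d → ℝ) :
    (Fin.snoc y 0 : Fin (d + 1) → ℝ) ∈ upperHalf d := by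
  simp [upperHalf]

lemma norm_le_norm_snoc_zero (y : Fin d → ℝ) : ‖y‖ ≤ ‖(Fin.snoc y 0 : Fin (d + 1) → ℝ)‖ :=
  (pi_norm_le_iff_of_nonneg (norm_nonneg _)).2 fun i => by
    simpa using norm_le_pi_norm (Fin.snoc y 0 : Fin (d + 1) → ℝ) i.castSucc

lemma HasCompactSupport.comp_snoc_zero {g : (Fin (d + 1) → ℝ) → ℝ} (hg : HasCompactSupport g) :
    HasCompactSupport fun y : Fin d → ℝ => g (Fin.snoc y 0) := by
  obtain ⟨R, hR⟩ := hg.isCompact.isBounded.subset_closedBall 0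
  refine HasCompactSupport.intro (isCompact_closedBall 0 R) fun y hy => ?_
  refine image_eq_zero_of_notMem_tsupport fun h => hy ?_
  have := hR h
  rw [mem_closedBall_zero_iff] at this ⊢
  exact (norm_le_norm_snoc_zero y).trans this

/-- The divergence theorem on the upper half-space for compactly supported vector fields. -/
lemma integral_upperHalf_sum_pd (X : Fin (d + 1) → (Fin (d + 1) → ℝ) → ℝ)
    (hX : ∀ i, ContDiff ℝ (⊤ : ℕ∞) (X i)) (hc : ∀ i, HasCompactSupport (X i)) :
    ∫ x in upperHalf d, ∑ i, pd i (X i) x = -∫ y : Fin d → ℝ, X (Fin.last d) (Fin.snoc y 0) := by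
  obtain ⟨R, hR0, hR⟩ : ∃ R, 0 < R ∧ (⋃ i, tsupport (X i)) ⊆ Metric.ball 0 R :=
    (isCompact_iUnion fun i => (hc i).isCompact).isBounded.subset_ball_lt 0 0
  have hout : ∀ i x, R ≤ ‖x‖ → x ∉ tsupport (X i) := fun i x hx hmem => by
    have := hR (mem_iUnion.2 ⟨i, hmem⟩)
    rw [mem_ball_zero_iff] at this
    exact absurd this (not_lt.2 hx)
  have hzero : ∀ i x, R ≤ ‖x‖ → X i x = 0 := fun i x hx =>
    image_eq_zero_of_notMem_tsupport (hout i x hx)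
  have hcoord : ∀ i j x, R ≤ |x j| → X i x = 0 := fun i j x hx =>
    hzero i x (hx.trans (norm_le_pi_norm x j))
  set a : Fin (d + 1) → ℝ := Fin.snoc (fun _ => -R) 0 with ha
  set b : Fin (d + 1) → ℝ := fun _ => R with hb
  have hle : a ≤ b := by
    intro i
    refine Fin.lastCases ?_ (fun j => ?_) i
    · simpa [ha, hb] using hR0.le
    · simp only [ha, hb, Fin.snoc_castSucc]; linarith
  have hcont : Continuous fun x => ∑ i, pd i (X i) x :=
    continuous_finsetSum _ fun i _ => (contDiff_pd i (hX i)).continuous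
  have hsub : Icc a b ⊆ upperHalf d := fun x hx => by
    simpa [ha, upperHalf] using hx.1 (Fin.last d)
  rw [setIntegral_eq_of_subset_of_forall_sdiff_eq_zero (isClosed_upperHalf d).measurableSet hsub]
  · have hdiv := integral_divergence_of_hasFDerivAt_off_countable' a b hle X
      (fun i x => fderiv ℝ (X i) x) ∅ countable_empty
      (fun i => (hX i).continuous.continuousOn)
      (fun x _ i => ((hX i).differentiableAt_of_smooth x).hasFDerivAt)
      (hcont.continuousOn.integrableOn_compact isCompact_Icc)
    refine hdiv.trans ?_
    rw [Fin.sum_univ_castSucc, Finset.sum_eq_zero fun i _ => ?_]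
    · have h1 : ∀ y : Fin d → ℝ, X (Fin.last d) ((Fin.last d).insertNth (b (Fin.last d)) y) = 0 :=
        fun y => hcoord _ (Fin.last d) _ (by simp [hb, le_abs_self])
      have h2 : ∀ y : Fin d → ℝ, X (Fin.last d) ((Fin.last d).insertNth (a (Fin.last d)) y)
          = X (Fin.last d) (Fin.snoc y 0) := fun y => by
        rw [Fin.insertNth_last']
        simp [ha]
      simp only [h1, h2, integral_zero, zero_add, zero_sub, neg_inj]
      refine setIntegral_eq_integral_of_forall_compl_eq_zero fun y hy => ?_
      by_contra hne
      refine hy ⟨fun i => ?_, fun i => ?_⟩ <;>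
      · have hlt : |y i| < R := by
          by_contra hcon
          exact hne (hcoord _ i.castSucc _ (by simpa using hcon))
        have := abs_lt.1 hlt
        simp only [Function.comp, Fin.succAbove_last, ha, hb, Fin.snoc_castSucc]
        linarith
    · have h1 : ∀ y : Fin d → ℝ, X i.castSucc (i.castSucc.insertNth (b i.castSucc) y) = 0 :=
        fun y => hcoord _ i.castSucc _ (by simp [hb, le_abs_self])
      have h2 : ∀ y : Fin d → ℝ, X i.castSucc (i.castSucc.insertNth (a i.castSucc) y) = 0 :=
        fun y => hcoord _ i.castSucc _ (by simp [ha, le_abs_self])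
      simp [h1, h2]
  · rintro x ⟨hxH, hx⟩
    refine Finset.sum_eq_zero fun i _ => pd_eq_zero_of_notMem_tsupport i (hout i x ?_)
    by_contra! hlt
    have hj : ∀ j, |x j| < R := fun j => (norm_le_pi_norm x j).trans_lt hlt
    refine hx ⟨fun j => ?_, fun j => (abs_lt.1 (hj j)).2.le⟩
    refine Fin.lastCases ?_ (fun k => ?_) j
    · simpa [ha, upperHalf] using hxH
    · simpa [ha] using (abs_lt.1 (hj k.castSucc)).1.le

lemma pd_castSucc_snoc_zero {f : (Fin (d + 1) → ℝ) → ℝ} (hf : ContDiff ℝ (⊤ : ℕ∞) f)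
    (h0 : ∀ y : Fin d → ℝ, f (Fin.snoc y 0) = 0) (i : Fin d) (y : Fin d → ℝ) :
    pd i.castSucc f (Fin.snoc y 0) = 0 := by
  have hline : HasDerivAt (fun t : ℝ => (Fin.snoc y 0 : Fin (d + 1) → ℝ)
      + t • Pi.single i.castSucc (1 : ℝ)) (Pi.single i.castSucc 1) 0 := by
    simpa using ((hasDerivAt_id (0 : ℝ)).smul_const
      (Pi.single i.castSucc (1 : ℝ) : Fin (d + 1) → ℝ)).const_add
        (Fin.snoc y 0 : Fin (d + 1) → ℝ)
  have hcomp : HasDerivAt (fun t : ℝ => f ((Fin.snoc y 0 : Fin (d + 1) → ℝ)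
      + t • Pi.single i.castSucc (1 : ℝ))) (pd i.castSucc f (Fin.snoc y 0)) 0 := by
    refine HasFDerivAt.comp_hasDerivAt (0 : ℝ) ?_ hline
    simpa using (hf.differentiableAt_of_smooth (Fin.snoc y 0)).hasFDerivAt
  have hconst : (fun t : ℝ => f ((Fin.snoc y 0 : Fin (d + 1) → ℝ)
      + t • Pi.single i.castSucc (1 : ℝ))) = fun _ => 0 := by
    funext t
    have : (Fin.snoc y 0 : Fin (d + 1) → ℝ) + t • Pi.single i.castSucc (1 : ℝ)
        = Fin.snoc (α := fun _ => ℝ) (y + t • Pi.single i (1 : ℝ)) 0 := by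
      funext j
      refine Fin.lastCases ?_ (fun k => ?_) j
      · simp [(Fin.castSucc_lt_last i).ne']
      · simp [Pi.single_apply]
    rw [this, h0]
  rw [hconst] at hcomp
  exact hcomp.unique (hasDerivAt_const _ _)

lemma bochnerField_last_snoc_zero {V f : (Fin (d + 1) → ℝ) → ℝ} (hf : ContDiff ℝ (⊤ : ℕ∞) f)
    (h0 : ∀ y : Fin d → ℝ, f (Fin.snoc y 0) = 0) (y : Fin d → ℝ) :
    bochnerField V f (Fin.last d) (Fin.snoc y 0)
      = pd (Fin.last d) V (Fin.snoc y 0) * (pd (Fin.last d) f (Fin.snoc y 0)) ^ 2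
        * exp (V (Fin.snoc y 0)) := by
  have h1 : ∀ i z, pd (Fin.castSucc i) f (Fin.snoc z 0) = 0 := pd_castSucc_snoc_zero hf h0
  have h2 : ∀ i : Fin d, hess i.castSucc i.castSucc f (Fin.snoc y 0) = 0 := fun i =>
    pd_castSucc_snoc_zero (contDiff_pd _ hf) (h1 i) i y
  simp only [bochnerField, Lop, lap, Fin.sum_univ_castSucc, h1, h2, mul_zero, zero_mul,
    Finset.sum_const_zero, zero_add]
  ring

/-- The quadratic form `-Hess_V - Q` along the gradient of `f`, with the weight `e^V`. -/
noncomputable def curvatureDensity (V : (Fin (d + 1) → ℝ) → ℝ)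
    (Q : (Fin (d + 1) → ℝ) → Matrix (Fin (d + 1)) (Fin (d + 1)) ℝ)
    (x : Fin (d + 1) → ℝ) (u : Fin (d + 1) → ℝ) : ℝ :=
  (∑ i, ∑ j, (-hess i j V x - Q x i j) * u i * u j) * exp (V x)

lemma continuous_curvatureDensity {V : (Fin (d + 1) → ℝ) → ℝ}
    {Q : (Fin (d + 1) → ℝ) → Matrix (Fin (d + 1)) (Fin (d + 1)) ℝ}
    (hV : ContDiff ℝ (⊤ : ℕ∞) V) (hQ : Continuous Q)
    {u : (Fin (d + 1) → ℝ) → Fin (d + 1) → ℝ} (hu : Continuous u) :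
    Continuous fun x => curvatureDensity V Q x (u x) := by
  refine Continuous.mul ?_ hV.continuous.rexp
  refine continuous_finsetSum _ fun i _ => continuous_finsetSum _ fun j _ => ?_
  exact (((contDiff_hess i j hV).continuous.neg.sub (hQ.matrix_elem i j)).mul
    ((continuous_apply i).comp hu)).mul ((continuous_apply j).comp hu)

lemma continuous_grad {f : (Fin (d + 1) → ℝ) → ℝ} (hf : ContDiff ℝ (⊤ : ℕ∞) f) :
    Continuous (grad f) :=
  continuous_pi fun i => (contDiff_pd i hf).continuous

lemma grad_eq_zero_of_notMem_tsupport {f : (Fin (d + 1) → ℝ) → ℝ} {x : Fin (d + 1) → ℝ}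
    (hx : x ∉ tsupport f) : grad f x = 0 :=
  funext fun i => pd_eq_zero_of_notMem_tsupport i hx

lemma curvatureDensity_zero (V : (Fin (d + 1) → ℝ) → ℝ)
    (Q : (Fin (d + 1) → ℝ) → Matrix (Fin (d + 1)) (Fin (d + 1)) ℝ) (x : Fin (d + 1) → ℝ) :
    curvatureDensity V Q x 0 = 0 := by
  simp [curvatureDensity]

lemma integrable_curvatureDensity_grad {V f : (Fin (d + 1) → ℝ) → ℝ}
    {Q : (Fin (d + 1) → ℝ) → Matrix (Fin (d + 1)) (Fin (d + 1)) ℝ}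
    (hV : ContDiff ℝ (⊤ : ℕ∞) V) (hQ : Continuous Q) (hf : ContDiff ℝ (⊤ : ℕ∞) f)
    (hc : HasCompactSupport f) : Integrable fun x => curvatureDensity V Q x (grad f x) :=
  (continuous_curvatureDensity hV hQ (continuous_grad hf)).integrable_of_hasCompactSupport
    (HasCompactSupport.intro hc.isCompact fun x hx => by
      rw [grad_eq_zero_of_notMem_tsupport hx, curvatureDensity_zero])

/-- Reilly's formula on the weighted half-space for functions with the Dirichlet condition. -/
lemma integral_upperHalf_reilly {V f : (Fin (d + 1) → ℝ) → ℝ}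
    {Q : (Fin (d + 1) → ℝ) → Matrix (Fin (d + 1)) (Fin (d + 1)) ℝ}
    (hV : ContDiff ℝ (⊤ : ℕ∞) V) (hQ : Continuous Q) (hf : ContDiff ℝ (⊤ : ℕ∞) f)
    (hc : HasCompactSupport f) (h0 : ∀ y : Fin d → ℝ, f (Fin.snoc y 0) = 0) :
    ∫ x in upperHalf d, ((Lop V f x) ^ 2 - hessHS2 f x
        - ∑ i, ∑ j, Q x i j * pd i f x * pd j f x) * exp (V x)
      = (∫ x in upperHalf d, curvatureDensity V Q x (grad f x))
        - ∫ y : Fin d → ℝ, pd (Fin.last d) V (Fin.snoc y 0)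
          * (pd (Fin.last d) f (Fin.snoc y 0)) ^ 2 * exp (V (Fin.snoc y 0)) := by
  have hpt : ∀ x, ((Lop V f x) ^ 2 - hessHS2 f x
        - ∑ i, ∑ j, Q x i j * pd i f x * pd j f x) * exp (V x)
      = curvatureDensity V Q x (grad f x) + ∑ i, pd i (bochnerField V f i) x := fun x => by
    rw [sum_pd_bochnerField hV hf]
    simp only [curvatureDensity, grad, sub_mul, neg_mul, Finset.sum_sub_distrib,
      Finset.sum_neg_distrib]
    ring
  have hXi : Integrable fun x => ∑ i, pd i (bochnerField V f i) x :=
    integrable_finsetSum _ fun i _ =>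
      (contDiff_pd i (contDiff_bochnerField hV hf i)).continuous.integrable_of_hasCompactSupport
        (hasCompactSupport_pd i (hasCompactSupport_bochnerField hc i))
  simp only [hpt]
  rw [integral_add (integrable_curvatureDensity_grad hV hQ hf hc).integrableOn hXi.integrableOn,
    integral_upperHalf_sum_pd _ (contDiff_bochnerField hV hf)
      (hasCompactSupport_bochnerField hc)]
  simp only [bochnerField_last_snoc_zero hf h0, sub_eq_add_neg]

/-- The integral inequality for a test function is equivalent to nonnegativity of the sum of an
interior and a boundary curvature term. -/
lemma bochner_inequality_iff {V f : (Fin (d + 1) → ℝ) → ℝ}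
    {Q : (Fin (d + 1) → ℝ) → Matrix (Fin (d + 1)) (Fin (d + 1)) ℝ} {q : (Fin d → ℝ) → ℝ}
    (hV : ContDiff ℝ (⊤ : ℕ∞) V) (hQ : Continuous Q) (hq : Continuous q)
    (hf : ContDiff ℝ (⊤ : ℕ∞) f)
    (hc : HasCompactSupport f) (h0 : ∀ y : Fin d → ℝ, f (Fin.snoc y 0) = 0) :
    ((∫ y : Fin d → ℝ,
        q y * (pd (Fin.last d) f (Fin.snoc y 0)) ^ 2 * exp (V (Fin.snoc y 0)))
      ≤ ∫ x in upperHalf d, ((Lop V f x) ^ 2 - hessHS2 f x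
        - ∑ i, ∑ j, Q x i j * pd i f x * pd j f x) * exp (V x))
    ↔ 0 ≤ (∫ x in upperHalf d, curvatureDensity V Q x (grad f x))
        + ∫ y : Fin d → ℝ, (-pd (Fin.last d) V (Fin.snoc y 0) - q y)
          * (pd (Fin.last d) f (Fin.snoc y 0)) ^ 2 * exp (V (Fin.snoc y 0)) := by
  have hintegrable : ∀ p : (Fin d → ℝ) → ℝ, Continuous p → Integrable fun y : Fin d → ℝ =>
      p y * (pd (Fin.last d) f (Fin.snoc y 0)) ^ 2 * exp (V (Fin.snoc y 0)) := fun p hp => by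
    refine Continuous.integrable_of_hasCompactSupport ?_ ?_
    · exact (hp.mul (((contDiff_pd _ hf).continuous.comp (continuous_snoc_zero d)).pow 2)).mul
        (hV.continuous.comp (continuous_snoc_zero d)).rexp
    · have := (hasCompactSupport_pd (Fin.last d) hc).comp_snoc_zero
      refine HasCompactSupport.intro this.isCompact fun y hy => ?_
      simp [image_eq_zero_of_notMem_tsupport hy]
  have hcV : Continuous fun y : Fin d → ℝ => pd (Fin.last d) V (Fin.snoc y 0) :=
    (contDiff_pd _ hV).continuous.comp (continuous_snoc_zero d)
  rw [integral_upperHalf_reilly hV hQ hf hc h0]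
  simp only [sub_mul, neg_mul]
  rw [integral_sub (by simpa only [neg_mul] using hintegrable (fun y => -_) hcV.neg)
    (hintegrable q hq), integral_neg]
  constructor <;> intro h <;> linarith

end HalfSpaceIntegrals

section TestFunctions

variable {d : ℕ} {V : (Fin (d + 1) → ℝ) → ℝ}
  {Q : (Fin (d + 1) → ℝ) → Matrix (Fin (d + 1)) (Fin (d + 1)) ℝ} {p : (Fin d → ℝ) → ℝ}

/-- The linear form `x ↦ ⟨v, x⟩`. -/
noncomputable def dotForm {n : ℕ} (v : Fin n → ℝ) : (Fin n → ℝ) →L[ℝ] ℝ :=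
  ∑ i, v i • ContinuousLinearMap.proj i

lemma dotForm_single {n : ℕ} (v : Fin n → ℝ) (i : Fin n) : dotForm v (Pi.single i 1) = v i := by
  simp [dotForm, Pi.single_apply]

lemma pd_oscillation {n : ℕ} {φ : (Fin n → ℝ) → ℝ} (hφ : ContDiff ℝ (⊤ : ℕ∞) φ)
    {h h' : ℝ → ℝ} (hh : ∀ t, HasDerivAt h (h' t) t) (v : Fin n → ℝ) {k : ℝ} (hk : k ≠ 0)
    (i : Fin n) (x : Fin n → ℝ) :
    pd i (fun y => φ y * (k * h (k⁻¹ * dotForm v y))) x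
      = k * h (k⁻¹ * dotForm v x) * pd i φ x + φ x * h' (k⁻¹ * dotForm v x) * v i := by
  have h1 : HasFDerivAt (fun y => k * h (k⁻¹ * dotForm v y))
      (k • (h' (k⁻¹ * dotForm v x) • (k⁻¹ • dotForm v))) x :=
    ((hh _).comp_hasFDerivAt x ((dotForm v).hasFDerivAt.const_mul k⁻¹)).const_mul k
  rw [pd_mul i (hφ.differentiableAt_of_smooth x) h1.differentiableAt]
  have h2 : pd i (fun y => k * h (k⁻¹ * dotForm v y)) x = h' (k⁻¹ * dotForm v x) * v i := by
    simp only [pd, h1.fderiv, _root_.smul_apply, dotForm_single, smul_eq_mul]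
    field_simp
  rw [h2]
  ring

lemma curvatureDensity_rotation (x a v : Fin (d + 1) → ℝ) (k s t : ℝ) :
    curvatureDensity V Q x (fun i => k * cos t * a i + s * -sin t * v i)
      + curvatureDensity V Q x (fun i => k * sin t * a i + s * cos t * v i)
      = k ^ 2 * curvatureDensity V Q x a + s ^ 2 * curvatureDensity V Q x v := by
  simp only [curvatureDensity, ← add_mul, ← mul_assoc, Finset.mul_sum, ← Finset.sum_add_distrib]
  congr 1
  refine Finset.sum_congr rfl fun i _ => Finset.sum_congr rfl fun j _ => ?_
  linear_combination (-hess i j V x - Q x i j) * (k ^ 2 * a i * a j + s ^ 2 * v i * v j)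
    * cos_sq_add_sin_sq t

lemma curvatureDensity_nonneg_of_interior (hV : ContDiff ℝ (⊤ : ℕ∞) V) (hQ : Continuous Q)
    (hpos : ∀ f : (Fin (d + 1) → ℝ) → ℝ, ContDiff ℝ (⊤ : ℕ∞) f → HasCompactSupport f →
      (∀ y : Fin d → ℝ, f (Fin.snoc y 0) = 0) →
      0 ≤ (∫ x in upperHalf d, curvatureDensity V Q x (grad f x))
        + ∫ y : Fin d → ℝ, p y * (pd (Fin.last d) f (Fin.snoc y 0)) ^ 2 * exp (V (Fin.snoc y 0)))
    {x₀ : Fin (d + 1) → ℝ} (hx₀ : 0 < x₀ (Fin.last d)) (v : Fin (d + 1) → ℝ) :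
    0 ≤ curvatureDensity V Q x₀ v := by
  by_contra! hneg
  have hcv : Continuous fun x => curvatureDensity V Q x v :=
    continuous_curvatureDensity hV hQ continuous_const
  set U : Set (Fin (d + 1) → ℝ) := {x | 0 < x (Fin.last d)} ∩ {x | curvatureDensity V Q x v < 0}
  have hU : IsOpen U := (isOpen_lt continuous_const (continuous_apply _)).inter
    (isOpen_lt hcv continuous_const)
  obtain ⟨φ, hφU, hφc, hφ, -, hφ1⟩ :=
    exists_contDiff_tsupport_subset (n := ⊤) (hU.mem_nhds ⟨hx₀, hneg⟩)
  have hφ0 : ∀ x, x ∉ U → φ x = 0 := fun x hx =>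
    image_eq_zero_of_notMem_tsupport fun h => hx (hφU h)
  have hbdry : ∀ y : Fin d → ℝ, (Fin.snoc y 0 : Fin (d + 1) → ℝ) ∉ U := fun y hy => by
    simpa using hy.1
  have hineq : ∀ k : ℝ, k ≠ 0 → ∀ h h' : ℝ → ℝ, ContDiff ℝ (⊤ : ℕ∞) h →
      (∀ t, HasDerivAt h (h' t) t) →
      Integrable (fun x => curvatureDensity V Q x (fun i =>
        k * h (k⁻¹ * dotForm v x) * pd i φ x + φ x * h' (k⁻¹ * dotForm v x) * v i)) ∧
      0 ≤ ∫ x in upperHalf d, curvatureDensity V Q x (fun i =>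
        k * h (k⁻¹ * dotForm v x) * pd i φ x + φ x * h' (k⁻¹ * dotForm v x) * v i) := by
    intro k hk h h' hs hh
    set f : (Fin (d + 1) → ℝ) → ℝ := fun y => φ y * (k * h (k⁻¹ * dotForm v y)) with hfdef
    have hf : ContDiff ℝ (⊤ : ℕ∞) f :=
      hφ.mul (contDiff_const.mul (hs.comp (contDiff_const.mul (dotForm v).contDiff)))
    have hfc : HasCompactSupport f := hφc.mul_right
    have hgrad : ∀ x, grad f x = fun i =>
        k * h (k⁻¹ * dotForm v x) * pd i φ x + φ x * h' (k⁻¹ * dotForm v x) * v i := fun x =>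
      funext fun i => pd_oscillation hφ hh v hk i x
    simp only [← hgrad]
    refine ⟨integrable_curvatureDensity_grad hV hQ hf hfc, ?_⟩
    have hzero : ∀ y : Fin d → ℝ, pd (Fin.last d) f (Fin.snoc y 0) = 0 := fun y => by
      refine pd_eq_zero_of_notMem_tsupport _ fun hmem => hbdry y (hφU ?_)
      exact (tsupport_mul_subset_left (f := φ)) hmem
    simpa [hzero] using hpos f hf hfc fun y => by simp [hfdef, hφ0 _ (hbdry y)]
  set A : ℝ := ∫ x in upperHalf d, curvatureDensity V Q x (grad φ x) with hA
  set B : ℝ := ∫ x in upperHalf d, φ x ^ 2 * curvatureDensity V Q x v with hB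
  have hcontB : Continuous fun x => φ x ^ 2 * curvatureDensity V Q x v :=
    (hφ.continuous.pow 2).mul hcv
  have hsuppB : HasCompactSupport fun x => φ x ^ 2 * curvatureDensity V Q x v :=
    HasCompactSupport.intro hφc.isCompact fun x hx => by
      simp [image_eq_zero_of_notMem_tsupport hx]
  have hAB : ∀ k : ℝ, k ≠ 0 → 0 ≤ k ^ 2 * A + B := by
    intro k hk
    obtain ⟨hi1, hp1⟩ := hineq k hk cos (fun t => -sin t) contDiff_cos hasDerivAt_cos
    obtain ⟨hi2, hp2⟩ := hineq k hk sin cos contDiff_sin hasDerivAt_sin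
    have hsum := add_nonneg hp1 hp2
    rw [← integral_add hi1.integrableOn hi2.integrableOn] at hsum
    simp only [curvatureDensity_rotation] at hsum
    change 0 ≤ ∫ x in upperHalf d, k ^ 2 * curvatureDensity V Q x (grad φ x)
      + φ x ^ 2 * curvatureDensity V Q x v at hsum
    rw [integral_add ((integrable_curvatureDensity_grad hV hQ hφ hφc).integrableOn.const_mul _)
      (hcontB.integrable_of_hasCompactSupport hsuppB).integrableOn, integral_const_mul] at hsum
    exact hsum
  have hBneg : B < 0 := by
    have hBfull : B = ∫ x, φ x ^ 2 * curvatureDensity V Q x v :=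
      setIntegral_eq_integral_of_forall_compl_eq_zero fun x hx => by
        rw [hφ0 x fun hxU => hx (show 0 ≤ x (Fin.last d) from le_of_lt hxU.1)]
        simp
    have hpos' : 0 < ∫ x, -(φ x ^ 2 * curvatureDensity V Q x v) := by
      refine hcontB.neg.integral_pos_of_hasCompactSupport_nonneg_nonzero (x := x₀)
        hsuppB.neg (fun x => ?_) ?_
      · by_cases hx : x ∈ U
        · exact neg_nonneg.2 (mul_nonpos_of_nonneg_of_nonpos (sq_nonneg _) (le_of_lt hx.2))
        · simp [hφ0 x hx]
      · simp [hφ1, hneg.ne]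
    rw [integral_neg] at hpos'
    linarith
  have hlim : Tendsto (fun k : ℝ => k ^ 2 * A + B) (𝓝[≠] 0) (𝓝 B) := by
    have : Continuous fun k : ℝ => k ^ 2 * A + B := by fun_prop
    simpa using (this.tendsto 0).mono_left nhdsWithin_le_nhds
  have := ge_of_tendsto hlim (eventually_nhdsWithin_of_forall fun k hk => hAB k hk)
  linarith

/-- The dilation by `N` in the normal direction. -/
noncomputable def normalDilation (d : ℕ) (N : ℝ) : (Fin (d + 1) → ℝ) →L[ℝ] (Fin (d + 1) → ℝ) :=
  ContinuousLinearMap.pi fun i =>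
    (if i = Fin.last d then N else 1) • ContinuousLinearMap.proj i

lemma normalDilation_apply (N : ℝ) (x : Fin (d + 1) → ℝ) (i : Fin (d + 1)) :
    normalDilation d N x i = (if i = Fin.last d then N else 1) * x i := by
  simp only [normalDilation, ContinuousLinearMap.pi_apply, _root_.smul_apply,
    ContinuousLinearMap.proj_apply, smul_eq_mul]

lemma normalDilation_snoc_zero (N : ℝ) (y : Fin d → ℝ) :
    normalDilation d N (Fin.snoc y 0) = Fin.snoc y 0 := by
  funext i
  rw [normalDilation_apply]
  refine Fin.lastCases ?_ (fun j => ?_) i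
  · simp
  · simp [(Fin.castSucc_lt_last j).ne]

lemma norm_le_norm_normalDilation {N : ℝ} (hN : 1 ≤ N) (x : Fin (d + 1) → ℝ) :
    ‖x‖ ≤ ‖normalDilation d N x‖ :=
  (pi_norm_le_iff_of_nonneg (norm_nonneg _)).2 fun i => by
    refine le_trans ?_ (norm_le_pi_norm _ i)
    rw [normalDilation_apply, norm_mul]
    refine le_mul_of_one_le_left (norm_nonneg _) ?_
    split_ifs
    · exact hN.trans (le_abs_self N)
    · simp

lemma pd_comp_normalDilation {Φ : (Fin (d + 1) → ℝ) → ℝ} (hΦ : ContDiff ℝ (⊤ : ℕ∞) Φ) (N : ℝ)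
    (i : Fin (d + 1)) (x : Fin (d + 1) → ℝ) :
    pd i (fun y => N⁻¹ * Φ (normalDilation d N y)) x
      = N⁻¹ * (if i = Fin.last d then N else 1) * pd i Φ (normalDilation d N x) := by
  have h1 : HasFDerivAt (fun y => N⁻¹ * Φ (normalDilation d N y))
      (N⁻¹ • (fderiv ℝ Φ (normalDilation d N x)).comp (normalDilation d N)) x :=
    ((hΦ.differentiableAt_of_smooth _).hasFDerivAt.comp x
      (normalDilation d N).hasFDerivAt).const_mul _
  have h2 : normalDilation d N (Pi.single i 1)
      = (if i = Fin.last d then N else 1) • Pi.single i (1 : ℝ) := by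
    funext j
    rw [normalDilation_apply]
    by_cases hij : j = i
    · subst hij; simp
    · simp [hij]
  simp only [pd, h1.fderiv, _root_.smul_apply, ContinuousLinearMap.comp_apply, h2,
    map_smul, smul_eq_mul]
  ring

lemma abs_curvatureDensity_le (x u : Fin (d + 1) → ℝ) :
    |curvatureDensity V Q x u| ≤
      (∑ i, ∑ j, |-hess i j V x - Q x i j|) * exp (V x) * ‖u‖ ^ 2 := by
  rw [curvatureDensity, abs_mul, abs_of_pos (exp_pos _), mul_right_comm]
  refine mul_le_mul_of_nonneg_right ?_ (exp_pos _).le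
  simp only [Finset.sum_mul]
  refine (Finset.abs_sum_le_sum_abs _ _).trans (Finset.sum_le_sum fun i _ => ?_)
  refine (Finset.abs_sum_le_sum_abs _ _).trans (Finset.sum_le_sum fun j _ => ?_)
  rw [mul_assoc, abs_mul, abs_mul, sq]
  exact mul_le_mul_of_nonneg_left
    (mul_le_mul (norm_le_pi_norm u i) (norm_le_pi_norm u j) (abs_nonneg _) (norm_nonneg _))
    (abs_nonneg _)

lemma boundary_integral_nonneg (hV : ContDiff ℝ (⊤ : ℕ∞) V) (hQ : Continuous Q)
    (hpos : ∀ f : (Fin (d + 1) → ℝ) → ℝ, ContDiff ℝ (⊤ : ℕ∞) f → HasCompactSupport f →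
      (∀ y : Fin d → ℝ, f (Fin.snoc y 0) = 0) →
      0 ≤ (∫ x in upperHalf d, curvatureDensity V Q x (grad f x))
        + ∫ y : Fin d → ℝ, p y * (pd (Fin.last d) f (Fin.snoc y 0)) ^ 2 * exp (V (Fin.snoc y 0)))
    {Φ : (Fin (d + 1) → ℝ) → ℝ} (hΦ : ContDiff ℝ (⊤ : ℕ∞) Φ) (hc : HasCompactSupport Φ)
    (h0 : ∀ y : Fin d → ℝ, Φ (Fin.snoc y 0) = 0) :
    0 ≤ ∫ y : Fin d → ℝ,
      p y * (pd (Fin.last d) Φ (Fin.snoc y 0)) ^ 2 * exp (V (Fin.snoc y 0)) := by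
  obtain ⟨R, hR⟩ := hc.isCompact.isBounded.subset_closedBall 0
  have hgc : HasCompactSupport (grad Φ) := HasCompactSupport.intro hc.isCompact fun x hx =>
    grad_eq_zero_of_notMem_tsupport hx
  obtain ⟨M, hM⟩ := hgc.exists_bound_of_continuous (continuous_grad hΦ)
  set f : ℕ → (Fin (d + 1) → ℝ) → ℝ := fun n y =>
    ((n : ℝ) + 1)⁻¹ * Φ (normalDilation d ((n : ℝ) + 1) y) with hfdef
  have hN : ∀ n : ℕ, (1 : ℝ) ≤ (n : ℝ) + 1 := fun n => by
    have := n.cast_nonneg (α := ℝ)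
    linarith
  have hf : ∀ n, ContDiff ℝ (⊤ : ℕ∞) (f n) := fun n =>
    contDiff_const.mul (hΦ.comp (normalDilation d _).contDiff)
  have hout : ∀ x : Fin (d + 1) → ℝ, R < ‖x‖ → x ∉ tsupport Φ := fun x hx hmem => by
    have := hR hmem
    rw [mem_closedBall_zero_iff] at this
    exact absurd this (not_le.2 hx)
  have hfc : ∀ n, HasCompactSupport (f n) := fun n =>
    HasCompactSupport.intro (isCompact_closedBall 0 R) fun x hx => by
      have hx' : R < ‖x‖ := by simpa using hx
      simp [hfdef, image_eq_zero_of_notMem_tsupport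
        (hout _ (hx'.trans_le (norm_le_norm_normalDilation (hN n) x)))]
  have hgrad : ∀ n x i, grad (f n) x i = ((n : ℝ) + 1)⁻¹ *
      (if i = Fin.last d then ((n : ℝ) + 1) else 1) *
        grad Φ (normalDilation d ((n : ℝ) + 1) x) i := fun n x i =>
    pd_comp_normalDilation hΦ _ i x
  have hgrad0 : ∀ (n : ℕ) x, R < ‖normalDilation d ((n : ℝ) + 1) x‖ → grad (f n) x = 0 := fun n x hx =>
    funext fun i => by
      rw [hgrad, grad_eq_zero_of_notMem_tsupport (hout _ hx)]
      simp
  have hgradM : ∀ n x, ‖grad (f n) x‖ ≤ M := fun n x => by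
    refine (pi_norm_le_iff_of_nonneg ((norm_nonneg _).trans (hM 0))).2 fun i => ?_
    rw [hgrad, norm_mul]
    refine (mul_le_of_le_one_left (norm_nonneg _) ?_).trans ((norm_le_pi_norm _ i).trans (hM _))
    have hpos : (0 : ℝ) < (n : ℝ) + 1 := zero_lt_one.trans_le (hN n)
    split_ifs
    · rw [inv_mul_cancel₀ hpos.ne', norm_one]
    · rw [mul_one, norm_inv, Real.norm_of_nonneg hpos.le]
      exact inv_le_one_of_one_le₀ (hN n)
  set b : (Fin (d + 1) → ℝ) → ℝ := fun x =>
    (∑ i, ∑ j, |-hess i j V x - Q x i j|) * exp (V x) * M ^ 2 with hb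
  have hbc : Continuous b := by
    refine Continuous.mul (Continuous.mul ?_ hV.continuous.rexp) continuous_const
    exact continuous_finsetSum _ fun i _ => continuous_finsetSum _ fun j _ =>
      ((contDiff_hess i j hV).continuous.neg.sub (hQ.matrix_elem i j)).abs
  have hlim : Tendsto (fun n => ∫ x in upperHalf d, curvatureDensity V Q x (grad (f n) x)) atTop
      (𝓝 (∫ x in upperHalf d, (0 : ℝ))) := by
    refine tendsto_integral_of_dominated_convergence ((Metric.closedBall 0 R).indicator b)
      (fun n => (integrable_curvatureDensity_grad hV hQ (hf n) (hfc n)).integrableOn.1) ?_ ?_ ?_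
    · exact ((integrable_indicator_iff Metric.isClosed_closedBall.measurableSet).2
        (hbc.continuousOn.integrableOn_compact (isCompact_closedBall 0 R))).integrableOn
    · refine fun n => Eventually.of_forall fun x => ?_
      by_cases hx : x ∈ Metric.closedBall (0 : Fin (d + 1) → ℝ) R
      · rw [indicator_of_mem hx]
        refine (abs_curvatureDensity_le x _).trans (mul_le_mul_of_nonneg_left ?_ ?_)
        · exact pow_le_pow_left₀ (norm_nonneg _) (hgradM n x) 2
        · positivity
      · rw [indicator_of_notMem hx, hgrad0, curvatureDensity_zero, norm_zero]
        have hx' : R < ‖x‖ := by simpa using hx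
        exact hx'.trans_le (norm_le_norm_normalDilation (hN n) x)
    · rw [ae_restrict_iff' (isClosed_upperHalf d).measurableSet]
      filter_upwards [Measure.ae_eval_ne (μ := fun _ : Fin (d + 1) => (volume : Measure ℝ))
        (Fin.last d) 0] with x hx0 hxH
      have hxpos : 0 < x (Fin.last d) := lt_of_le_of_ne hxH hx0.symm
      refine tendsto_const_nhds.congr' ?_
      filter_upwards [(tendsto_natCast_atTop_atTop (R := ℝ)).eventually_gt_atTop
        (R / x (Fin.last d))] with n hn
      rw [hgrad0, curvatureDensity_zero]
      refine lt_of_lt_of_le ?_ (norm_le_pi_norm _ (Fin.last d))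
      rw [normalDilation_apply, if_pos rfl]
      refine lt_of_lt_of_le ?_ (le_abs_self _)
      rw [div_lt_iff₀ hxpos] at hn
      linarith
  have hbd : ∀ n (y : Fin d → ℝ), pd (Fin.last d) (f n) (Fin.snoc y 0)
      = pd (Fin.last d) Φ (Fin.snoc y 0) := fun n y => by
    rw [hfdef, pd_comp_normalDilation hΦ, normalDilation_snoc_zero, if_pos rfl,
      inv_mul_cancel₀ (zero_lt_one.trans_le (hN n)).ne', one_mul]
  rw [integral_zero] at hlim
  have hfin := ge_of_tendsto' (hlim.add_const (∫ y : Fin d → ℝ,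
    p y * (pd (Fin.last d) Φ (Fin.snoc y 0)) ^ 2 * exp (V (Fin.snoc y 0)))) fun n => by
      have := hpos (f n) (hf n) (hfc n) fun y => by
        simp [hfdef, normalDilation_snoc_zero, h0]
      simp only [hbd] at this
      exact this
  simpa using hfin

lemma boundary_nonneg (hV : ContDiff ℝ (⊤ : ℕ∞) V) (hQ : Continuous Q) (hp : Continuous p)
    (hpos : ∀ f : (Fin (d + 1) → ℝ) → ℝ, ContDiff ℝ (⊤ : ℕ∞) f → HasCompactSupport f →
      (∀ y : Fin d → ℝ, f (Fin.snoc y 0) = 0) →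
      0 ≤ (∫ x in upperHalf d, curvatureDensity V Q x (grad f x))
        + ∫ y : Fin d → ℝ, p y * (pd (Fin.last d) f (Fin.snoc y 0)) ^ 2 * exp (V (Fin.snoc y 0)))
    (y₀ : Fin d → ℝ) : 0 ≤ p y₀ := by
  by_contra! hneg
  have hinit : Continuous fun x : Fin (d + 1) → ℝ => (fun i => x i.castSucc : Fin d → ℝ) := by
    fun_prop
  set U : Set (Fin (d + 1) → ℝ) := {x | p (fun i => x i.castSucc) < 0} with hUdef
  have hU : IsOpen U := isOpen_lt (hp.comp hinit) continuous_const
  have hsnocU : ∀ y : Fin d → ℝ, (Fin.snoc y 0 : Fin (d + 1) → ℝ) ∈ U ↔ p y < 0 := fun y => by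
    simp [hUdef]
  obtain ⟨θ, hθU, hθc, hθ, -, hθ1⟩ :=
    exists_contDiff_tsupport_subset (n := ⊤) (hU.mem_nhds ((hsnocU y₀).2 hneg))
  have hlast : ContDiff ℝ (⊤ : ℕ∞) fun x : Fin (d + 1) → ℝ => x (Fin.last d) :=
    contDiff_apply ℝ ℝ (Fin.last d)
  have hpd : ∀ y : Fin d → ℝ, pd (Fin.last d) (fun x => x (Fin.last d) * θ x) (Fin.snoc y 0)
      = θ (Fin.snoc y 0) := fun y => by
    have h1 : pd (Fin.last d) (fun x : Fin (d + 1) → ℝ => x (Fin.last d)) (Fin.snoc y 0) = 1 := by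
      have := (ContinuousLinearMap.proj (R := ℝ) (φ := fun _ : Fin (d + 1) => ℝ)
        (Fin.last d)).hasFDerivAt (x := (Fin.snoc y 0 : Fin (d + 1) → ℝ))
      rw [pd, HasFDerivAt.fderiv (f := fun x : Fin (d + 1) → ℝ => x (Fin.last d)) this]
      simp
    rw [pd_mul _ (hlast.differentiableAt_of_smooth _) (hθ.differentiableAt_of_smooth _), h1]
    simp
  have hintegrable := boundary_integral_nonneg hV hQ hpos (hlast.mul hθ) hθc.mul_left fun y => by simp
  simp only [hpd] at hintegrable
  have hcont : Continuous fun y : Fin d → ℝ => p y * θ (Fin.snoc y 0) ^ 2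
      * exp (V (Fin.snoc y 0)) :=
    (hp.mul ((hθ.continuous.comp (continuous_snoc_zero d)).pow 2)).mul
      (hV.continuous.comp (continuous_snoc_zero d)).rexp
  have hpos' : 0 < ∫ y : Fin d → ℝ, -(p y * θ (Fin.snoc y 0) ^ 2 * exp (V (Fin.snoc y 0))) := by
    refine hcont.neg.integral_pos_of_hasCompactSupport_nonneg_nonzero (x := y₀)
      (HasCompactSupport.intro hθc.comp_snoc_zero.isCompact fun y hy => ?_) (fun y => ?_) ?_
    · simp [image_eq_zero_of_notMem_tsupport hy]
    · by_cases hy : p y < 0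
      · exact neg_nonneg.2 (mul_nonpos_of_nonpos_of_nonneg
          (mul_nonpos_of_nonpos_of_nonneg hy.le (sq_nonneg _)) (exp_pos _).le)
      · simp [image_eq_zero_of_notMem_tsupport fun h => hy ((hsnocU y).1 (hθU h))]
    · simp [hθ1, hneg.ne, (exp_pos _).ne']
  rw [integral_neg] at hpos'
  linarith

lemma curvatureDensity_nonneg (hV : ContDiff ℝ (⊤ : ℕ∞) V) (hQ : Continuous Q)
    (hintegrable : ∀ x : Fin (d + 1) → ℝ, 0 < x (Fin.last d) → ∀ v, 0 ≤ curvatureDensity V Q x v)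
    {x : Fin (d + 1) → ℝ} (hx : x ∈ upperHalf d) (v : Fin (d + 1) → ℝ) :
    0 ≤ curvatureDensity V Q x v := by
  have hcont : Continuous fun t : ℝ =>
      curvatureDensity V Q (x + t • Pi.single (Fin.last d) (1 : ℝ)) v :=
    (continuous_curvatureDensity (u := fun _ => v) hV hQ continuous_const).comp (by fun_prop)
  have hlim := (hcont.tendsto 0).mono_left (nhdsWithin_le_nhds (s := Ioi 0))
  simp only [zero_smul, add_zero] at hlim
  refine ge_of_tendsto hlim (eventually_nhdsWithin_of_forall fun t ht => hintegrable _ ?_ v)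
  simpa using add_pos_of_nonneg_of_pos (show 0 ≤ x (Fin.last d) from hx) ht

lemma posSemidef_iff_curvatureDensity_nonneg (hV : ContDiff ℝ (⊤ : ℕ∞) V) {x : Fin (d + 1) → ℝ}
    (hQs : (Q x).IsSymm) :
    ((Matrix.of fun i j => -hess i j V x) - Q x).PosSemidef
      ↔ ∀ v, 0 ≤ curvatureDensity V Q x v := by
  rw [Matrix.posSemidef_iff_dotProduct_mulVec, and_iff_right]
  · refine forall_congr' fun v => ?_
    rw [curvatureDensity, mul_nonneg_iff_of_pos_right (exp_pos _)]
    have : star v ⬝ᵥ (((Matrix.of fun i j => -hess i j V x) - Q x).mulVec v)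
        = ∑ i, ∑ j, (-hess i j V x - Q x i j) * v i * v j := by
      simp only [dotProduct, Matrix.mulVec, Finset.mul_sum]
      refine Finset.sum_congr rfl fun i _ => Finset.sum_congr rfl fun j _ => ?_
      simp
      ring
    rw [this]
  · ext i j
    simp [hess_comm j i hV, hQs.apply i j]

end TestFunctions

end HalfSpace

/-- half-space case of Theorem 2.2(3): for a continuous symmetric matrix
field `Q` on `H` and a continuous `q : ℝ^{d-1} → ℝ`, the conditions
`−Hess_V − Q ⪰ 0` on `H` and `−∂_d V(·,0) ≥ q` on the boundary hold if and only if
`∫_H { (Lf)² − ‖Hess_f‖²_HS − ⟨Q ∇f, ∇f⟩ } dμ ≥ ∫_{∂H} q (∂_d f(·,0))² dμ_∂`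
for every `f ∈ C_c^∞` satisfying the Dirichlet condition, where `μ = e^V dx` and
`μ_∂ = e^{V(·,0)} dxb`.  (Ambient dimension is `d + 1` with `d ≥ 1`.) -/
theorem half_space_curvature_characterization_dirichlet
    (d : ℕ) (hd : 1 ≤ d) (V : (Fin (d + 1) → ℝ) → ℝ) (hV : ContDiff ℝ (⊤ : ℕ∞) V)
    (Q : (Fin (d + 1) → ℝ) → Matrix (Fin (d + 1)) (Fin (d + 1)) ℝ)
    (q : (Fin d → ℝ) → ℝ)
    (hQc : ContinuousOn Q (upperHalf d)) (hqc : Continuous q)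
    (hQs : ∀ x ∈ upperHalf d, (Q x).IsSymm) :
    ((∀ x ∈ upperHalf d,
        ((Matrix.of fun i j => -hess i j V x) - Q x).PosSemidef)
      ∧ (∀ xb : Fin d → ℝ, q xb ≤ -pd (Fin.last d) V (Fin.snoc xb 0)))
    ↔ (∀ f : (Fin (d + 1) → ℝ) → ℝ, ContDiff ℝ (⊤ : ℕ∞) f → HasCompactSupport f →
        (∀ xb : Fin d → ℝ, f (Fin.snoc xb 0) = 0) →
        (∫ xb : Fin d → ℝ,
            q xb * (pd (Fin.last d) f (Fin.snoc xb 0)) ^ 2 * exp (V (Fin.snoc xb 0)))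
          ≤ ∫ x in upperHalf d,
              ((Lop V f x) ^ 2 - hessHS2 f x
                - ∑ i, ∑ j, Q x i j * pd i f x * pd j f x) * exp (V x)) := by
  set r : (Fin (d + 1) → ℝ) → Fin (d + 1) → ℝ := fun x =>
    Function.update x (Fin.last d) (max (x (Fin.last d)) 0) with hr
  have hr_mem : ∀ x, r x ∈ upperHalf d := fun x => by simp [hr, upperHalf]
  have hr_id : ∀ x ∈ upperHalf d, r x = x := fun x hx => by
    simp only [hr, max_eq_left (show 0 ≤ x (Fin.last d) from hx), Function.update_eq_self]
  have hr_cont : Continuous r :=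
    continuous_id.update _ ((continuous_apply _).max continuous_const)
  have hQ : Continuous fun x => Q (r x) := hQc.comp_continuous hr_cont hr_mem
  have hp : Continuous fun y : Fin d → ℝ => -pd (Fin.last d) V (Fin.snoc y 0) - q y :=
    ((contDiff_pd _ hV).continuous.comp (continuous_snoc_zero d)).neg.sub hqc
  have hpsd : ∀ x ∈ upperHalf d, ((Matrix.of fun i j => -hess i j V x) - Q x).PosSemidef
      ↔ ∀ v, 0 ≤ curvatureDensity V (fun x => Q (r x)) x v := fun x hx => by
    have h := posSemidef_iff_curvatureDensity_nonneg (Q := fun x => Q (r x)) (x := x) hV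
      (hQs _ (hr_mem x))
    simpa only [hr_id x hx] using h
  have hii : ∀ f : (Fin (d + 1) → ℝ) → ℝ, ∫ x in upperHalf d, ((Lop V f x) ^ 2 - hessHS2 f x
        - ∑ i, ∑ j, Q x i j * pd i f x * pd j f x) * exp (V x)
      = ∫ x in upperHalf d, ((Lop V f x) ^ 2 - hessHS2 f x
        - ∑ i, ∑ j, Q (r x) i j * pd i f x * pd j f x) * exp (V x) := fun f =>
    setIntegral_congr_fun (isClosed_upperHalf d).measurableSet fun x hx => by
      simp only [hr_id x hx]
  simp only [hii]
  constructor
  · rintro ⟨hcurv, hbd⟩ f hf hc h0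
    rw [bochner_inequality_iff hV hQ hqc hf hc h0]
    refine add_nonneg (setIntegral_nonneg (isClosed_upperHalf d).measurableSet fun x hx =>
      (hpsd x hx).1 (hcurv x hx) _) (integral_nonneg fun y => ?_)
    exact mul_nonneg (mul_nonneg (sub_nonneg.2 (hbd y)) (sq_nonneg _)) (exp_pos _).le
  · intro h
    have hpos := fun f hf hc h0 => (bochner_inequality_iff hV hQ hqc hf hc h0).1 (h f hf hc h0)
    refine ⟨fun x hx => (hpsd x hx).2 fun v => ?_, fun y =>
      sub_nonneg.1 (boundary_nonneg hV hQ hp hpos y)⟩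
    exact curvatureDensity_nonneg hV hQ
      (fun z hz w => curvatureDensity_nonneg_of_interior hV hQ hpos hz w) hx v
end

section
/- Let δ > 0, C > 0, and let h : ℝ → ℝ be twice differentiable on [0, δ] with h(r) > 0 for all r ∈ [0, δ]. Assume that h''(r) ≥ h'(r)²/h(r) − C for every r ∈ [0, δ] with h'(r) ≥ 0. If r₀ ∈ [0, δ) satisfies h'(r₀) > 0 and h'(r₀)² ≥ 4C·h(r₀), then for every r ∈ [r₀, δ] one has h'(r) > 0 and h'(r)² ≥ 4C·h(r). -/
open Set

/-- A function with positive right derivative at `x` exceeds its value at `x` just to the right. -/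
theorem HasDerivWithinAt.eventually_lt_of_deriv_pos {f : ℝ → ℝ} {f' x : ℝ}
    (hf : HasDerivWithinAt f f' (Ioi x) x) (hf' : 0 < f') :
    ∀ᶠ y in nhdsWithin x (Ioi x), f x < f y := by
  have hs := (hasDerivWithinAt_iff_tendsto_slope' self_notMem_Ioi).1 hf
  filter_upwards [hs.eventually_const_lt hf', self_mem_nhdsWithin] with y hy hxy
  rw [slope_def_field] at hy
  have := (div_pos_iff_of_pos_right (sub_pos.2 hxy)).1 hy
  linarith

/-- propagation step in the proof of Lemma 3.2: if `h > 0` on `[0, δ]`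
is twice differentiable with `h'' ≥ h'²/h − C` wherever `h' ≥ 0`, and at some
`r₀ ∈ [0, δ)` one has `h'(r₀) > 0` and `h'(r₀)² ≥ 4C h(r₀)`, then `h' > 0` and
`h'² ≥ 4C h` on all of `[r₀, δ]`. -/
theorem propagation_of_gradient_bound
    (δ C : ℝ) (hδ : 0 < δ) (hC : 0 < C) (h h' h'' : ℝ → ℝ)
    (hder1 : ∀ r ∈ Icc (0 : ℝ) δ, HasDerivWithinAt h (h' r) (Icc (0 : ℝ) δ) r)
    (hder2 : ∀ r ∈ Icc (0 : ℝ) δ, HasDerivWithinAt h' (h'' r) (Icc (0 : ℝ) δ) r)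
    (hpos : ∀ r ∈ Icc (0 : ℝ) δ, 0 < h r)
    (hineq : ∀ r ∈ Icc (0 : ℝ) δ, 0 ≤ h' r → h' r ^ 2 / h r - C ≤ h'' r)
    (r₀ : ℝ) (hr₀ : r₀ ∈ Ico (0 : ℝ) δ)
    (h1 : 0 < h' r₀) (h2 : 4 * C * h r₀ ≤ h' r₀ ^ 2) :
    ∀ r ∈ Icc r₀ δ, 0 < h' r ∧ 4 * C * h r ≤ h' r ^ 2 := by
  have hsub : Icc r₀ δ ⊆ Icc 0 δ := Icc_subset_Icc_left hr₀.1
  have hch : ContinuousOn h (Icc r₀ δ) := fun r hr =>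
    ((hder1 r (hsub hr)).continuousWithinAt).mono hsub
  have hch' : ContinuousOn h' (Icc r₀ δ) := fun r hr =>
    ((hder2 r (hsub hr)).continuousWithinAt).mono hsub
  have hclosed : IsClosed ({r | 0 ≤ h' r ∧ 4 * C * h r ≤ h' r ^ 2} ∩ Icc r₀ δ) := by
    have hA := isClosed_Icc.isClosed_le (continuousOn_const (c := (0 : ℝ))) hch'
    have hB := isClosed_Icc.isClosed_le (hch.const_mul (4 * C)) (hch'.pow 2)
    convert hA.inter hB using 1
    ext r
    simp only [mem_inter_iff, mem_ofPred_eq, Pi.pow_apply]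
    tauto
  have hpos' : ∀ r ∈ Icc (0 : ℝ) δ, 0 ≤ h' r → 4 * C * h r ≤ h' r ^ 2 → 0 < h' r := by
    intro r hr h0 hle
    have := mul_pos hC (hpos r hr)
    exact h0.lt_of_ne fun h => by rw [← h] at hle; linarith
  have key : Icc r₀ δ ⊆ {r | 0 ≤ h' r ∧ 4 * C * h r ≤ h' r ^ 2} := by
    refine hclosed.Icc_subset_of_forall_exists_gt ⟨h1.le, h2⟩ ?_
    rintro x ⟨⟨hx0, hxle⟩, hx⟩ y hy
    have hxI : x ∈ Icc (0 : ℝ) δ := hsub (Ico_subset_Icc_self hx)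
    have hxpos := hpos' x hxI hx0 hxle
    have hmem : Icc (0 : ℝ) δ ∈ nhdsWithin x (Ioi x) :=
      Filter.mem_of_superset (Ioc_mem_nhdsGT hx.2)
        fun z hz => ⟨hxI.1.trans hz.1.le, hz.2⟩
    have d1 := (hder1 x hxI).mono_of_mem_nhdsWithin hmem
    have d2 := (hder2 x hxI).mono_of_mem_nhdsWithin hmem
    have hquot : 4 * C ≤ h' x ^ 2 / h x := (le_div_iff₀ (hpos x hxI)).2 hxle
    have hsnd : 3 * C ≤ h'' x := by linarith [hineq x hxI hx0]
    have hF := ((d2.mul d2).sub (d1.const_mul (4 * C))).eventually_lt_of_deriv_pos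
      (by nlinarith [mul_le_mul_of_nonneg_left hsnd hx0, mul_pos hxpos hC])
    have hev := d2.continuousWithinAt.eventually_const_lt hxpos
    obtain ⟨z, hz, hz', hzy⟩ := (hF.and (hev.and (Ioc_mem_nhdsGT hy))).exists
    refine ⟨z, ⟨hz'.le, ?_⟩, hzy⟩
    simp only [Pi.sub_apply, Pi.mul_apply] at hz
    nlinarith
  intro r hr
  exact ⟨hpos' r (hsub hr) (key hr).1 (key hr).2, (key hr).2⟩
end

section
/- Let δ > 0, C > 0, and let h : ℝ → ℝ be twice differentiable on [0, δ] with h(r) > 0 for all r ∈ [0, δ]. Assume that h''(r) ≥ h'(r)²/h(r) − C for every r ∈ [0, δ] with h'(r) ≥ 0, and that r₀ ∈ [0, δ) satisfies h'(r₀) > 0 and h'(r₀)² ≥ 4C·h(r₀). Then h(r) ≥ C·(r − r₀)² for every r ∈ [r₀, δ]; consequently ∫_{r₀}^{δ} h(r) dr ≥ (C/3)·(δ − r₀)³. -/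
open Set

/-- A function with right derivative pointing upward whenever it meets the level `c` stays above
that level. -/
theorem le_of_right_deriv_pos_of_eq {a b c : ℝ} {w w' : ℝ → ℝ}
    (hw : ContinuousOn w (Icc a b))
    (hw' : ∀ x ∈ Ico a b, HasDerivWithinAt w (w' x) (Ici x) x) (ha : c ≤ w a)
    (hc : ∀ x ∈ Ico a b, w x = c → 0 < w' x) {x : ℝ} (hx : x ∈ Icc a b) : c ≤ w x :=
  neg_le_neg_iff.1 <| image_le_of_deriv_right_lt_deriv_boundary (f := fun y => -w y)
    (B := fun _ => -c) (B' := fun _ => 0) hw.neg (fun y hy => (hw' y hy).neg)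
    (neg_le_neg ha) (fun y => hasDerivAt_const y (-c))
    (fun y hy hyc => neg_lt_zero.2 (hc y hy (neg_injective hyc))) hx

/-- A function that grows at rate at least `m` lies above the line of slope `m` through its
initial value. -/
theorem add_mul_sub_le_of_le_right_deriv {a b m : ℝ} {s s' : ℝ → ℝ}
    (hs : ContinuousOn s (Icc a b))
    (hs' : ∀ x ∈ Ico a b, HasDerivWithinAt s (s' x) (Ici x) x)
    (hm : ∀ x ∈ Ico a b, m ≤ s' x) {x : ℝ} (hx : x ∈ Icc a b) : s a + m * (x - a) ≤ s x := by
  refine image_le_of_deriv_right_le_deriv_boundary (f := fun y => s a + m * (y - a))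
    (f' := fun _ => m) (by fun_prop) (fun y _ => ?_) (by simp) hs hs' hm hx
  simpa using ((((hasDerivAt_id y).sub_const a).const_mul m).const_add (s a)).hasDerivWithinAt

/-- quadratic growth step in the proof of Lemma 3.2: if `h > 0` on
`[0, δ]` is twice differentiable with `h'' ≥ h'²/h − C` wherever `h' ≥ 0`, and at
some `r₀ ∈ [0, δ)` one has `h'(r₀) > 0` and `h'(r₀)² ≥ 4C h(r₀)`, then
`h(r) ≥ C (r − r₀)²` on `[r₀, δ]`; consequently `∫_{r₀}^{δ} h ≥ (C/3)(δ − r₀)³`. -/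
theorem quadratic_growth_of_gradient_bound
    (δ C : ℝ) (hδ : 0 < δ) (hC : 0 < C) (h h' h'' : ℝ → ℝ)
    (hder1 : ∀ r ∈ Icc (0 : ℝ) δ, HasDerivWithinAt h (h' r) (Icc (0 : ℝ) δ) r)
    (hder2 : ∀ r ∈ Icc (0 : ℝ) δ, HasDerivWithinAt h' (h'' r) (Icc (0 : ℝ) δ) r)
    (hpos : ∀ r ∈ Icc (0 : ℝ) δ, 0 < h r)
    (hineq : ∀ r ∈ Icc (0 : ℝ) δ, 0 ≤ h' r → h' r ^ 2 / h r - C ≤ h'' r)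
    (r₀ : ℝ) (hr₀ : r₀ ∈ Ico (0 : ℝ) δ)
    (h1 : 0 < h' r₀) (h2 : 4 * C * h r₀ ≤ h' r₀ ^ 2) :
    (∀ r ∈ Icc r₀ δ, C * (r - r₀) ^ 2 ≤ h r)
    ∧ (C / 3) * (δ - r₀) ^ 3 ≤ ∫ r in r₀..δ, h r := by
  obtain ⟨hr0, hrδ⟩ := hr₀
  have hsub : Icc r₀ δ ⊆ Icc 0 δ := Icc_subset_Icc_left hr0
  have right {f : ℝ → ℝ} {d x : ℝ} (hx : x ∈ Ico r₀ δ)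
      (hf : HasDerivWithinAt f d (Icc 0 δ) x) : HasDerivWithinAt f d (Ici x) x :=
    hf.mono_of_mem_nhdsWithin <| Filter.mem_of_superset (Icc_mem_nhdsGE hx.2)
      (Icc_subset_Icc_left (hr0.trans hx.1))
  have hspos : ∀ r ∈ Icc (0 : ℝ) δ, 0 < √(h r) := fun r hr => Real.sqrt_pos.2 (hpos r hr)
  have hsqrt : ∀ r ∈ Icc (0 : ℝ) δ,
      HasDerivWithinAt (fun x => √(h x)) (h' r / (2 * √(h r))) (Icc 0 δ) r :=
    fun r hr => (hder1 r hr).sqrt (hpos r hr).ne'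
  have hquot := fun r (hr : r ∈ Icc (0 : ℝ) δ) => (hder2 r hr).fun_div (hsqrt r hr) (hspos r hr).ne'
  have hCpos : 0 < √C := Real.sqrt_pos.2 hC
  have hC2 : √C ^ 2 = C := Real.sq_sqrt hC.le
  have hgrad : ∀ r ∈ Icc r₀ δ, 2 * √C ≤ h' r / √(h r) := by
    intro r hr
    refine le_of_right_deriv_pos_of_eq
      (fun x hx => (hquot x (hsub hx)).continuousWithinAt.mono hsub)
      (fun x hx => right hx (hquot x (hsub (Ico_subset_Icc_self hx)))) ?_ ?_ hr
    · have hr₀' := hsub (left_mem_Icc.2 hrδ.le)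
      rw [le_div_iff₀ (hspos _ hr₀')]
      refine (sq_le_sq₀ (by positivity) h1.le).1 ?_
      rw [mul_pow, mul_pow, hC2, Real.sq_sqrt (hpos _ hr₀').le]
      linarith
    · intro x hx hxe
      have hx' := hsub (Ico_subset_Icc_self hx)
      have hs := hspos x hx'
      have hs2 : √(h x) ^ 2 = h x := Real.sq_sqrt (hpos x hx').le
      have he : h' x = 2 * √C * √(h x) := (div_eq_iff hs.ne').1 hxe
      have hsq : h' x ^ 2 / h x = 4 * C := by
        rw [he, mul_pow, mul_pow, hC2, hs2, mul_div_cancel_right₀ _ (hpos x hx').ne']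
        norm_num
      have hi := hineq x hx' (by rw [he]; positivity)
      have hcross : h' x * (h' x / (2 * √(h x))) = 2 * C * √(h x) := by
        rw [he]
        field_simp
        rw [hC2]
      rw [hcross]
      refine div_pos ?_ (by positivity)
      nlinarith
  have hgrowth : ∀ r ∈ Icc r₀ δ, C * (r - r₀) ^ 2 ≤ h r := by
    intro r hr
    have hline := add_mul_sub_le_of_le_right_deriv (m := √C)
      (fun x hx => (hsqrt x (hsub hx)).continuousWithinAt.mono hsub)
      (fun x hx => right hx (hsqrt x (hsub (Ico_subset_Icc_self hx))))
      (fun x hx => by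
        have := hgrad x (Ico_subset_Icc_self hx)
        rw [mul_comm 2, ← div_div]
        linarith) hr
    have hs₀ := Real.sqrt_nonneg (h r₀)
    have hnonneg : 0 ≤ √C * (r - r₀) := mul_nonneg hCpos.le (sub_nonneg.2 hr.1)
    calc C * (r - r₀) ^ 2 = (√C * (r - r₀)) ^ 2 := by rw [mul_pow, hC2]
      _ ≤ √(h r) ^ 2 := pow_le_pow_left₀ hnonneg (by linarith) 2
      _ = h r := Real.sq_sqrt (hpos r (hsub hr)).le
  refine ⟨hgrowth, ?_⟩
  have hint : ∫ r in r₀..δ, C * (r - r₀) ^ 2 = C / 3 * (δ - r₀) ^ 3 := by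
    rw [intervalIntegral.integral_const_mul,
      intervalIntegral.integral_comp_sub_right (fun x => x ^ 2), integral_pow]
    norm_num
    ring
  rw [← hint]
  refine intervalIntegral.integral_mono_on hrδ.le
    (Continuous.intervalIntegrable (by fun_prop) _ _)
    (ContinuousOn.intervalIntegrable_of_Icc hrδ.le ?_) hgrowth
  exact fun x hx => (hder1 x (hsub hx)).continuousWithinAt.mono hsub
end

section
/- Let T > 0, C > 0, and let h : ℝ → ℝ be twice differentiable on [0, T] with h(r) > 0 for all r ∈ [0, T] and h'(0) = 0. Assume h''(r) ≥ h'(r)²/h(r) − C for every r ∈ [0, T], and assume that for every r ∈ [0, T] with h'(r) > 0 one has h'(r)² < 4C·h(r). Then h'(r)² ≤ 5C·h(r) for every r ∈ [0, T]. -/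
open Set

/-- Step (2) of the proof of Lemma 3.2: if `h > 0` on `[0, T]` is twice
differentiable with `h'(0) = 0` and `h'' ≥ h'²/h − C` on `[0, T]`, and whenever
`h'(r) > 0` one has `h'(r)² < 4C h(r)`, then `h'² ≤ 5C h` on all of `[0, T]`. -/
theorem gradient_bound_five
    (T C : ℝ) (hT : 0 < T) (hC : 0 < C) (h h' h'' : ℝ → ℝ)
    (hder1 : ∀ r ∈ Icc (0 : ℝ) T, HasDerivWithinAt h (h' r) (Icc (0 : ℝ) T) r)
    (hder2 : ∀ r ∈ Icc (0 : ℝ) T, HasDerivWithinAt h' (h'' r) (Icc (0 : ℝ) T) r)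
    (hpos : ∀ r ∈ Icc (0 : ℝ) T, 0 < h r)
    (h0 : h' 0 = 0)
    (hineq : ∀ r ∈ Icc (0 : ℝ) T, h' r ^ 2 / h r - C ≤ h'' r)
    (hlt : ∀ r ∈ Icc (0 : ℝ) T, 0 < h' r → h' r ^ 2 < 4 * C * h r) :
    ∀ r ∈ Icc (0 : ℝ) T, h' r ^ 2 ≤ 5 * C * h r := by
  have hder : ∀ r ∈ Icc (0 : ℝ) T, HasDerivWithinAt (fun r => h' r ^ 2 - 5 * C * h r)
      (2 * h' r * h'' r - 5 * C * h' r) (Icc (0 : ℝ) T) r := fun r hr => by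
    refine (((hder2 r hr).pow 2).sub ((hder1 r hr).const_mul (5 * C))).congr_deriv ?_
    simp
  have key := image_le_of_deriv_right_lt_deriv_boundary
    (f := fun r => h' r ^ 2 - 5 * C * h r) (f' := fun r => 2 * h' r * h'' r - 5 * C * h' r)
    (a := 0) (b := T) (B := fun _ => 0) (B' := fun _ => 0)
    (fun r hr => (hder r hr).continuousWithinAt)
    (fun r hr => (hder r (Ico_subset_Icc_self hr)).mono_of_mem_nhdsWithin
      (Icc_mem_nhdsGE_of_mem hr))
    (by
      have := mul_pos hC (hpos 0 ⟨le_rfl, hT.le⟩)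
      simp only [h0]
      linarith)
    (fun _ => hasDerivAt_const _ _)
    (fun r hr hr0 => by
      have hr := Ico_subset_Icc_self hr
      have hp := hpos r hr
      have hCh := mul_pos hC hp
      have hsq : h' r ^ 2 = 5 * C * h r := sub_eq_zero.mp hr0
      have hne : h' r ≠ 0 := fun h00 => by
        rw [h00] at hsq
        linarith
      have hneg : h' r < 0 := hne.lt_of_le <| not_lt.mp fun hgt => by
        linarith [hlt r hr hgt]
      have hsecond := hineq r hr
      rw [hsq, mul_div_cancel_right₀ _ hp.ne'] at hsecond
      have : h' r * (2 * h'' r - 5 * C) < 0 := mul_neg_of_neg_of_pos hneg (by linarith)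
      linarith)
  exact fun r hr => sub_nonpos.mp (key hr)
end

section
/- For every δ > 0, C > 0 and c₀ > 0 there exist λ₀ > 0 and M > 0, depending only on δ, C, c₀, with the following property: for every λ ≥ λ₀ and every h : ℝ → ℝ that is twice differentiable on [0, δ], satisfies h(r) > 0 on [0, δ], h'(0) = 0, h''(r) ≥ h'(r)²/h(r) − C for all r ∈ [0, δ], and ∫_0^{δ} h(r) dr ≤ c₀/λ, one has h(0) ≤ M·λ^{−2/3}. -/
open Set Real

/-- A function with vanishing initial slope and second derivative at least `-C` stays above the
parabola `h 0 - C r² / 2`. -/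
theorem sub_mul_sq_div_two_le_of_second_deriv_ge {δ C : ℝ} {h h' h'' : ℝ → ℝ}
    (hh : ∀ r ∈ Icc (0 : ℝ) δ, HasDerivWithinAt h (h' r) (Icc (0 : ℝ) δ) r)
    (hh' : ∀ r ∈ Icc (0 : ℝ) δ, HasDerivWithinAt h' (h'' r) (Icc (0 : ℝ) δ) r)
    (h0 : h' 0 = 0) (hC : ∀ r ∈ Icc (0 : ℝ) δ, -C ≤ h'' r) {r : ℝ} (hr : r ∈ Icc (0 : ℝ) δ) :
    h 0 - C * r ^ 2 / 2 ≤ h r := by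
  have hz : (0 : ℝ) ∈ Icc (0 : ℝ) δ := ⟨le_rfl, hr.1.trans hr.2⟩
  have d1 : ∀ x ∈ Icc (0 : ℝ) δ,
      HasDerivWithinAt (fun x => h' x + C * x) (h'' x + C) (Icc (0 : ℝ) δ) x := fun x hx =>
    ((hh' x hx).add ((hasDerivWithinAt_id x _).const_mul C)).congr_deriv (by rw [mul_one])
  have m1 : MonotoneOn (fun x => h' x + C * x) (Icc (0 : ℝ) δ) :=
    monotoneOn_of_hasDerivWithinAt_nonneg (convex_Icc _ _)
      (fun x hx => (d1 x hx).continuousWithinAt)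
      (fun x hx => (d1 x (interior_subset hx)).mono interior_subset)
      (fun x hx => by linarith [hC x (interior_subset hx)])
  have d2 : ∀ x ∈ Icc (0 : ℝ) δ,
      HasDerivWithinAt (fun x => h x + C / 2 * x ^ 2) (h' x + C * x) (Icc (0 : ℝ) δ) x :=
    fun x hx => by
      refine ((hh x hx).add (((hasDerivWithinAt_id x _).pow 2).const_mul (C / 2))).congr_deriv ?_
      simp only [id]
      ring
  have m2 : MonotoneOn (fun x => h x + C / 2 * x ^ 2) (Icc (0 : ℝ) δ) :=
    monotoneOn_of_hasDerivWithinAt_nonneg (convex_Icc _ _)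
      (fun x hx => (d2 x hx).continuousWithinAt)
      (fun x hx => (d2 x (interior_subset hx)).mono interior_subset)
      (fun x hx => by
        have hx' := interior_subset hx
        simpa [h0] using m1 hz hx' hx'.1)
  have := m2 hz hr hr.1
  simp only at this
  linarith

/-- analytic content of Lemma 3.2: for every `δ, C, c₀ > 0` there are
`λ₀, M > 0` such that any `h` which is twice differentiable and positive on `[0, δ]`,
satisfies the Neumann condition `h'(0) = 0`, the differential inequality
`h'' ≥ h'²/h − C` on `[0, δ]`, and the integral bound `∫_0^δ h ≤ c₀/λ` for some
`λ ≥ λ₀`, must satisfy `h(0) ≤ M λ^{−2/3}`. -/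
theorem boundary_L2_estimate_analytic
    (δ C c₀ : ℝ) (hδ : 0 < δ) (hC : 0 < C) (hc₀ : 0 < c₀) :
    ∃ lam₀ M : ℝ, 0 < lam₀ ∧ 0 < M ∧
      ∀ lam : ℝ, lam₀ ≤ lam →
        ∀ h h' h'' : ℝ → ℝ,
          (∀ r ∈ Icc (0 : ℝ) δ, HasDerivWithinAt h (h' r) (Icc (0 : ℝ) δ) r) →
          (∀ r ∈ Icc (0 : ℝ) δ, HasDerivWithinAt h' (h'' r) (Icc (0 : ℝ) δ) r) →
          (∀ r ∈ Icc (0 : ℝ) δ, 0 < h r) →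
          h' 0 = 0 →
          (∀ r ∈ Icc (0 : ℝ) δ, h' r ^ 2 / h r - C ≤ h'' r) →
          (∫ r in (0 : ℝ)..δ, h r) ≤ c₀ / lam →
          h 0 ≤ M * lam ^ (-(2 : ℝ) / 3) := by
  have hK : 1 ≤ 2 * c₀ / C + 1 := by
    have : 0 < 2 * c₀ / C := by positivity
    linarith
  have hCK : 2 * c₀ ≤ C * (2 * c₀ / C + 1) := by
    have : C * (2 * c₀ / C + 1) = 2 * c₀ + C := by field_simp
    linarith
  set K := 2 * c₀ / C + 1
  refine ⟨1, C * K ^ 2 + 2 * c₀ / δ, one_pos, by positivity, ?_⟩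
  intro lam hlam h h' h'' hh hh' hpos hn hineq hint
  have hlam0 : 0 < lam := by linarith
  obtain ⟨t, ht0, ht1, ht2, ht3⟩ : ∃ t : ℝ, 0 < t ∧ t ≤ 1 ∧ t ^ 2 = lam ^ (-(2 : ℝ) / 3) ∧
      t ^ 3 = lam⁻¹ := by
    refine ⟨lam ^ (-(1 : ℝ) / 3), by positivity, rpow_le_one_of_one_le_of_nonpos hlam (by norm_num),
      ?_, ?_⟩
    · rw [← rpow_natCast, ← rpow_mul hlam0.le]
      norm_num
    · rw [← rpow_natCast, ← rpow_mul hlam0.le, ← rpow_neg_one]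
      norm_num
  rw [← ht2]
  rw [div_eq_mul_inv, ← ht3] at hint
  have hlow : ∀ r ∈ Icc (0 : ℝ) δ, h 0 - C * r ^ 2 / 2 ≤ h r := fun r hr =>
    sub_mul_sq_div_two_le_of_second_deriv_ge hh hh' hn (fun x hx => by
      have : 0 ≤ h' x ^ 2 / h x := div_nonneg (sq_nonneg _) (hpos x hx).le
      linarith [hineq x hx]) hr
  have hcont : ContinuousOn h (Icc 0 δ) := fun x hx => (hh x hx).continuousWithinAt
  have key : ∀ ρ, 0 ≤ ρ → ρ ≤ δ → C * ρ ^ 2 ≤ h 0 → ρ * h 0 ≤ 2 * c₀ * t ^ 3 := by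
    intro ρ hρ0 hρδ hρ
    have i1 : IntervalIntegrable h MeasureTheory.volume 0 δ :=
      hcont.intervalIntegrable_of_Icc hδ.le
    have i2 : IntervalIntegrable h MeasureTheory.volume 0 ρ :=
      (hcont.mono (Icc_subset_Icc_right hρδ)).intervalIntegrable_of_Icc hρ0
    have e1 : ∫ r in (0 : ℝ)..ρ, h r ≤ ∫ r in (0 : ℝ)..δ, h r :=
      intervalIntegral.integral_mono_interval le_rfl hρ0 hρδ
        ((MeasureTheory.ae_restrict_mem measurableSet_Ioc).mono
          fun x hx => (hpos x (Ioc_subset_Icc_self hx)).le) i1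
    have e2 : ∫ _ in (0 : ℝ)..ρ, h 0 / 2 ≤ ∫ r in (0 : ℝ)..ρ, h r := by
      refine intervalIntegral.integral_mono_on hρ0 intervalIntegrable_const i2 fun x hx => ?_
      have hx2 : C * x ^ 2 ≤ C * ρ ^ 2 := by
        gcongr
        exacts [hx.1, hx.2]
      linarith [hlow x ⟨hx.1, hx.2.trans hρδ⟩]
    simp only [intervalIntegral.integral_const, sub_zero, smul_eq_mul] at e2
    linarith
  rcases le_total (C * δ ^ 2) (h 0) with hcase | hcase
  · have h1 := key δ hδ.le le_rfl hcase
    have h2 : t ^ 3 ≤ t ^ 2 := pow_le_pow_of_le_one ht0.le ht1 (by norm_num)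
    calc h 0 ≤ 2 * c₀ * t ^ 3 / δ := by rw [le_div_iff₀ hδ]; linarith
      _ ≤ 2 * c₀ * t ^ 2 / δ := by gcongr
      _ = 2 * c₀ / δ * t ^ 2 := by ring
      _ ≤ (C * K ^ 2 + 2 * c₀ / δ) * t ^ 2 := by
        gcongr
        exact le_add_of_nonneg_left (by positivity)
  · have hp : 0 < h 0 := hpos 0 ⟨le_rfl, hδ.le⟩
    obtain ⟨ρ, hρ0, hρ⟩ : ∃ ρ, 0 ≤ ρ ∧ h 0 = C * ρ ^ 2 := by
      refine ⟨√(h 0 / C), sqrt_nonneg _, ?_⟩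
      rw [sq_sqrt (by positivity)]
      field_simp
    have hρδ : ρ ≤ δ := by
      rw [hρ] at hcase
      exact le_of_pow_le_pow_left₀ two_ne_zero hδ.le (le_of_mul_le_mul_left hcase hC)
    have h1 := key ρ hρ0 hρδ hρ.ge
    rw [hρ] at h1 ⊢
    have h2 : C * ρ ^ 3 ≤ C * (K * t) ^ 3 := by
      calc C * ρ ^ 3 ≤ 2 * c₀ * t ^ 3 := by linarith
        _ ≤ C * K * t ^ 3 := by gcongr
        _ ≤ C * K ^ 3 * t ^ 3 := by
          gcongr
          exact le_self_pow₀ hK (by norm_num)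
        _ = C * (K * t) ^ 3 := by ring
    have h3 : ρ ≤ K * t :=
      le_of_pow_le_pow_left₀ (by norm_num) (by positivity) (le_of_mul_le_mul_left h2 hC)
    calc C * ρ ^ 2 ≤ C * (K * t) ^ 2 := by gcongr
      _ = C * K ^ 2 * t ^ 2 := by ring
      _ ≤ (C * K ^ 2 + 2 * c₀ / δ) * t ^ 2 := by
        gcongr
        exact le_add_of_nonneg_right (by positivity)
end
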